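/- Let R be a commutative Noetherian ring with 1 that has no finite homomorphic images (i.e., R/p is infinite for every maximal ideal p), with dim Max R = d. Then every finite separable associative unital R-algebra A can be generated by d + 2 elements as a non-unital R-algebra. -/

import Mathlib

open TensorProduct

/-- `s` generates `A` as a non-unital (non-associative) `R`-algebra: every `R`-submodule of `A`
containing `s` and closed under multiplication is all of `A` (equivalently, the smallest such
submodule is `⊤`). -/
def GeneratesAsNonUnitalAlgebra (R : Type*) {A : Type*} [CommSemiring R]
    [NonUnitalNonAssocSemiring A] [Module R A] (s : Set A) : Prop :=
  ∀ B : Submodule R A, s ⊆ (B : Set A) → (∀ x ∈ B, ∀ y ∈ B, x * y ∈ B) → B = ⊤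

attribute [local instance] TensorProduct.Algebra.module

/-- `A` has a separability element: some `∑ xᵢ ⊗ yᵢ` with `∑ xᵢ * yᵢ = 1` and
`∑ a * xᵢ ⊗ yᵢ = ∑ xᵢ ⊗ yᵢ * a` for every `a`. -/
def HasSeparabilityElement (R A : Type*) [CommRing R] [Ring A] [Algebra R A] : Prop :=
  ∃ e : A ⊗[R] A, LinearMap.mul' R A e = 1 ∧
    ∀ a : A, (LinearMap.mulLeft R a).rTensor A e = (LinearMap.mulRight R a).lTensor A e

section Separability

variable {R A : Type*} [CommRing R] [Ring A] [Algebra R A]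

theorem HasSeparabilityElement.of_projective
    (h : Module.Projective (A ⊗[R] Aᵐᵒᵖ) A) : HasSeparabilityElement R A := by
  let μ : (A ⊗[R] Aᵐᵒᵖ) →ₗ[A ⊗[R] Aᵐᵒᵖ] A := LinearMap.toSpanSingleton _ _ 1
  have hμ : Function.Surjective μ := fun a ↦ ⟨a ⊗ₜ 1, by
    simp [μ, TensorProduct.Algebra.smul_def]⟩
  obtain ⟨σ, hσ⟩ := Module.projective_lifting_property μ LinearMap.id hμ
  let T : (A ⊗[R] Aᵐᵒᵖ) →ₗ[R] A ⊗[R] A :=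
    (MulOpposite.opLinearEquiv R (M := A)).symm.toLinearMap.lTensor A
  have hmul (z : A ⊗[R] Aᵐᵒᵖ) : LinearMap.mul' R A (T z) = z • (1 : A) := by
    induction z with
    | zero => rw [map_zero, map_zero]; exact (zero_smul (A ⊗[R] Aᵐᵒᵖ) (1 : A)).symm
    | add x y hx hy => rw [map_add, map_add, hx, hy, add_smul]
    | tmul x y => simp [T, TensorProduct.Algebra.smul_def]
  have hleft (a : A) (z : A ⊗[R] Aᵐᵒᵖ) :
      (LinearMap.mulLeft R a).rTensor A (T z) = T ((a ⊗ₜ 1) * z) := by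
    induction z with
    | zero => simp
    | add x y hx hy => rw [map_add, map_add, hx, hy, mul_add, map_add]
    | tmul x y => simp [T]
  have hright (a : A) (z : A ⊗[R] Aᵐᵒᵖ) :
      (LinearMap.mulRight R a).lTensor A (T z) = T ((1 ⊗ₜ MulOpposite.op a) * z) := by
    induction z with
    | zero => simp
    | add x y hx hy => rw [map_add, map_add, hx, hy, mul_add, map_add]
    | tmul x y => simp [T]
  refine ⟨T (σ 1), ?_, fun a ↦ ?_⟩
  · rw [hmul]
    exact LinearMap.congr_fun hσ 1
  · rw [hleft, hright, ← smul_eq_mul, ← smul_eq_mul, ← map_smul, ← map_smul]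
    simp [TensorProduct.Algebra.smul_def]

theorem HasSeparabilityElement.baseChange (S : Type*) [CommRing S] [Algebra R S]
    (h : HasSeparabilityElement R A) : HasSeparabilityElement S (S ⊗[R] A) := by
  obtain ⟨e, he, hcomm⟩ := h
  let J : A ⊗[R] A →ₗ[R] (S ⊗[R] A) ⊗[S] (S ⊗[R] A) := TensorProduct.lift <|
    LinearMap.mk₂ R (fun a b ↦ ((1 : S) ⊗ₜ[R] a) ⊗ₜ[S] ((1 : S) ⊗ₜ[R] b))
      (fun _ _ _ ↦ by rw [tmul_add, add_tmul])
      (fun _ _ _ ↦ by rw [tmul_smul]; rfl)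
      (fun _ _ _ ↦ by rw [tmul_add, tmul_add])
      (fun _ _ _ ↦ by rw [tmul_smul, tmul_smul])
  have hJ (a b : A) : J (a ⊗ₜ b) = ((1 : S) ⊗ₜ[R] a) ⊗ₜ[S] ((1 : S) ⊗ₜ[R] b) := rfl
  have hmul (z : A ⊗[R] A) :
      LinearMap.mul' S (S ⊗[R] A) (J z) = 1 ⊗ₜ LinearMap.mul' R A z := by
    induction z with
    | zero => simp
    | add x y hx hy => rw [map_add, map_add, hx, hy, map_add, tmul_add]
    | tmul x y => simp [hJ]
  have hleft (a : A) (z : A ⊗[R] A) :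
      (LinearMap.mulLeft S ((1 : S) ⊗ₜ[R] a)).rTensor (S ⊗[R] A) (J z) =
        J ((LinearMap.mulLeft R a).rTensor A z) := by
    induction z with
    | zero => simp
    | add x y hx hy => rw [map_add, map_add, hx, hy, map_add, map_add]
    | tmul x y => simp [hJ]
  have hright (a : A) (z : A ⊗[R] A) :
      (LinearMap.mulRight S ((1 : S) ⊗ₜ[R] a)).lTensor (S ⊗[R] A) (J z) =
        J ((LinearMap.mulRight R a).lTensor A z) := by
    induction z with
    | zero => simp
    | add x y hx hy => rw [map_add, map_add, hx, hy, map_add, map_add]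
    | tmul x y => simp [hJ]
  refine ⟨J e, by rw [hmul, he, Algebra.TensorProduct.one_def], fun a ↦ ?_⟩
  induction a with
  | zero => simp
  | add x y hx hy =>
    have h1 : LinearMap.mulLeft S (x + y) = LinearMap.mulLeft S x + LinearMap.mulLeft S y := by
      ext; simp [add_mul]
    have h2 : LinearMap.mulRight S (x + y) =
        LinearMap.mulRight S x + LinearMap.mulRight S y := by
      ext; simp [mul_add]
    rw [h1, h2, LinearMap.rTensor_add, LinearMap.lTensor_add, LinearMap.add_apply,
      LinearMap.add_apply, hx, hy]
  | tmul s a =>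
    have hs : s ⊗ₜ[R] a = s • ((1 : S) ⊗ₜ[R] a) := by simp [smul_tmul']
    have h1 : LinearMap.mulLeft S (s ⊗ₜ[R] a) = s • LinearMap.mulLeft S ((1 : S) ⊗ₜ[R] a) := by
      rw [hs]; ext; simp
    have h2 : LinearMap.mulRight S (s ⊗ₜ[R] a) =
        s • LinearMap.mulRight S ((1 : S) ⊗ₜ[R] a) := by
      rw [hs]; ext; simp
    rw [h1, h2, LinearMap.rTensor_smul, LinearMap.lTensor_smul, LinearMap.smul_apply,
      LinearMap.smul_apply, hleft, hright, hcomm]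

theorem HasSeparabilityElement.isSemisimpleRing {K B : Type*} [Field K] [Ring B] [Algebra K B]
    (h : HasSeparabilityElement K B) : IsSemisimpleRing B := by
  obtain ⟨e, he, hcomm⟩ := h
  refine (isSemisimpleModule_iff B B).2 ⟨fun N ↦ ?_⟩
  obtain ⟨π₀, hπ₀⟩ := (N.restrictScalars K).subtype.exists_leftInverse_of_injective
    (by rw [Submodule.ker_subtype])
  let π : B →ₗ[K] B := (N.restrictScalars K).subtype ∘ₗ π₀
  have hπ (x : B) : π x ∈ N := (π₀ x).2
  have hπN (x : B) (hx : x ∈ N) : π x = x :=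
    congrArg Subtype.val (LinearMap.congr_fun hπ₀ ⟨x, hx⟩)
  let P (b : B) : B ⊗[K] B →ₗ[K] B :=
    LinearMap.mul' K B ∘ₗ (π ∘ₗ LinearMap.mulRight K b).lTensor B
  have hP (b x y : B) : P b (x ⊗ₜ y) = x * π (y * b) := rfl
  have hPN (b : B) (z : B ⊗[K] B) : P b z ∈ N := by
    induction z with
    | zero => simp
    | add x y hx hy => rw [map_add]; exact N.add_mem hx hy
    | tmul x y => exact N.smul_mem x (hπ _)
  have hadd (b c : B) (z : B ⊗[K] B) : P (b + c) z = P b z + P c z := by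
    induction z with
    | zero => simp
    | add x y hx hy => rw [map_add, hx, hy, map_add, map_add]; abel
    | tmul x y => simp [hP, mul_add]
  have hleft (a b : B) (z : B ⊗[K] B) :
      P b ((LinearMap.mulLeft K a).rTensor B z) = a * P b z := by
    induction z with
    | zero => simp
    | add x y hx hy => rw [map_add, map_add, hx, hy, map_add, mul_add]
    | tmul x y => simp [hP, mul_assoc]
  have hright (a b : B) (z : B ⊗[K] B) :
      P b ((LinearMap.mulRight K a).lTensor B z) = P (a * b) z := by
    induction z with
    | zero => simp
    | add x y hx hy => rw [map_add, map_add, hx, hy, map_add]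
    | tmul x y => simp [hP, mul_assoc]
  have hfix (x : B) (hx : x ∈ N) (z : B ⊗[K] B) : P x z = LinearMap.mul' K B z * x := by
    induction z with
    | zero => simp
    | add y z hy hz => rw [map_add, hy, hz, map_add, add_mul]
    | tmul y z => rw [hP, hπN (z * x) (N.smul_mem z hx), LinearMap.mul'_apply, mul_assoc]
  let ρ : B →ₗ[B] N :=
    { toFun := fun b ↦ ⟨P b e, hPN b e⟩
      map_add' := fun b c ↦ Subtype.ext (hadd b c e)
      map_smul' := fun a b ↦ Subtype.ext <| by
        change P (a * b) e = a * P b e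
        rw [← hright, ← hcomm, hleft] }
  refine ⟨LinearMap.ker ρ, LinearMap.isCompl_of_proj fun x ↦ Subtype.ext ?_⟩
  change P x e = x
  rw [hfix x x.2, he, one_mul]

end Separability

section FieldGenerators

theorem GeneratesAsNonUnitalAlgebra.image {R A B : Type*} [CommRing R] [Ring A] [Algebra R A]
    [Ring B] [Algebra R B] {s : Set A} (h : GeneratesAsNonUnitalAlgebra R s) (f : A ≃ₐ[R] B) :
    GeneratesAsNonUnitalAlgebra R (f '' s) := by
  intro V hs hV
  have := h (V.comap f.toLinearMap) (fun a ha ↦ hs ⟨a, ha, rfl⟩)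
    (fun x hx y hy ↦ by simpa using hV _ hx _ hy)
  refine Submodule.eq_top_iff'.2 fun b ↦ ?_
  have hb : f.symm b ∈ V.comap f.toLinearMap := this ▸ Submodule.mem_top
  simpa using hb

theorem generatesAsNonUnitalAlgebra_singleton_pi {K J : Type*} [Field K] [Finite J]
    {c : J → K} (hc : Function.Injective c) (hc0 : ∀ j, c j ≠ 0) :
    GeneratesAsNonUnitalAlgebra K ({c} : Set (J → K)) := by
  classical
  cases nonempty_fintype J
  intro V hs hV
  have hcV : c ∈ V := hs rfl
  have hpoly (Q : Polynomial K) : (fun j ↦ c j * Q.eval (c j)) ∈ V := by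
    induction Q using Polynomial.induction_on' with
    | add p q hp hq =>
      convert V.add_mem hp hq using 1
      ext j
      simp [mul_add]
    | monomial n a =>
      have hn : c ^ (n + 1) ∈ V := by
        induction n with
        | zero => simpa using hcV
        | succ n ih => rw [pow_succ]; exact hV _ ih _ hcV
      convert V.smul_mem a hn using 1
      ext j
      simp
      ring
  refine Submodule.eq_top_iff'.2 fun f ↦ ?_
  convert hpoly (Lagrange.interpolate Finset.univ c fun j ↦ f j / c j) using 1
  ext j
  rw [Lagrange.eval_interpolate_at_node _ hc.injOn (Finset.mem_univ j),
    mul_div_cancel₀ _ (hc0 j)]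

theorem exists_generatesAsNonUnitalAlgebra_pi_matrix (K : Type*) [Field K] [Infinite K]
    {ι : Type*} [Fintype ι] [DecidableEq ι] (d : ι → ℕ) :
    ∃ v : Bool → ∀ i, Matrix (Fin (d i)) (Fin (d i)) K,
      GeneratesAsNonUnitalAlgebra K (Set.range v) := by
  classical
  let J := Σ i, Fin (d i)
  have : Infinite Kˣ := unitsEquivNeZero.infinite_iff.2
    (Set.finite_singleton 0).infinite_compl.to_subtype
  obtain ⟨u⟩ : Nonempty (J ↪ Kˣ) := ⟨(Finite.equivFin J).toEmbedding.trans
    (Fin.valEmbedding.trans (Infinite.natEmbedding Kˣ))⟩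
  let c : J → K := fun j ↦ u j
  let D : (J → K) →ₗ[K] ∀ i, Matrix (Fin (d i)) (Fin (d i)) K :=
    { toFun := fun f i ↦ Matrix.diagonal fun j ↦ f ⟨i, j⟩
      map_add' := fun f g ↦ by ext i : 1; simp [Matrix.diagonal_add]
      map_smul' := fun a f ↦ by
        ext i : 1
        simp only [Pi.smul_apply, RingHom.id_apply, ← Matrix.diagonal_smul]
        rfl }
  have hD (f : J → K) (i : ι) : D f i = Matrix.diagonal fun j ↦ f ⟨i, j⟩ := rfl
  let b : ∀ i, Matrix (Fin (d i)) (Fin (d i)) K := fun i ↦ Matrix.of fun _ _ ↦ 1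
  refine ⟨fun t ↦ if t then D c else b, fun V hs hV ↦ ?_⟩
  have hb : b ∈ V := hs ⟨false, by simp⟩
  have hc : D c ∈ V := hs ⟨true, by simp⟩
  have hcomap : V.comap D = ⊤ :=
    generatesAsNonUnitalAlgebra_singleton_pi (Units.val_injective.comp u.injective)
      (fun j ↦ (u j).ne_zero) _ (Set.singleton_subset_iff.2 hc) fun f hf g hg ↦ by
        have := hV _ hf _ hg
        have hfg : D (f * g) = D f * D g := by
          ext i : 1
          simp [hD]
        rwa [Submodule.mem_comap, hfg]
  have hDV (f : J → K) : D f ∈ V := by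
    change f ∈ V.comap D
    simp [hcomap]
  refine Submodule.eq_top_iff'.2 fun M ↦ ?_
  have hM : M = ∑ p : J, D (Pi.single p 1) * b * D (Matrix.blockDiagonal' M p) := by
    ext i j l
    simp only [Finset.sum_apply, Matrix.sum_apply, Pi.mul_apply, hD, Matrix.mul_diagonal,
      Matrix.diagonal_mul]
    rw [Finset.sum_eq_single ⟨i, j⟩]
    · simp [b]
    · intro p _ hp
      simp [hp.symm]
    · simp
  rw [hM]
  exact V.sum_mem fun p _ ↦ hV _ (hV _ (hDV _) _ hb) _ (hDV _)

open Algebra.TensorProduct in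
theorem toMatrix_lift_map {k S T B ι α : Type*} [CommRing k] [CommRing S] [CommRing T]
    [Algebra k S] [Algebra k T] [Ring B] [Algebra k B] (b : Module.Basis ι k B) (φ : S →ₐ[k] T)
    (x : α → S ⊗[k] B) (w : ι → FreeSemigroup α) :
    (basis T b).toMatrix
        (fun i ↦ FreeSemigroup.lift (fun t ↦ map φ (AlgHom.id k B) (x t)) (w i)) =
      ((basis S b).toMatrix fun i ↦ FreeSemigroup.lift x (w i)).map φ := by
  have hlift (p : FreeSemigroup α) :
      FreeSemigroup.lift (fun t ↦ map φ (AlgHom.id k B) (x t)) p =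
        map φ (AlgHom.id k B) (FreeSemigroup.lift x p) := by
    induction p using FreeSemigroup.recOnMul with
    | ih1 t => simp
    | ih2 t p ht hp => rw [map_mul, map_mul, ht, hp, map_mul]
  have hrepr (z : S ⊗[k] B) (i : ι) :
      (basis T b).repr (map φ (AlgHom.id k B) z) i = φ ((basis S b).repr z i) := by
    induction z with
    | zero => simp
    | add y z hy hz => simp [hy, hz]
    | tmul s y => simp
  ext i j
  simp [Module.Basis.toMatrix_apply, hlift, hrepr]

open Algebra.TensorProduct in
/-- Generation by two elements descends along extensions of an infinite field. -/
theorem exists_generatesAsNonUnitalAlgebra_of_baseChange {k K B : Type*} [Field k] [Infinite k]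
    [Field K] [Algebra k K] [Ring B] [Algebra k B] [Module.Finite k B]
    {v : Bool → K ⊗[k] B} (hv : GeneratesAsNonUnitalAlgebra K (Set.range v)) :
    ∃ w : Bool → B, GeneratesAsNonUnitalAlgebra k (Set.range w) := by
  classical
  let ι := Module.Free.ChooseBasisIndex k B
  let b : Module.Basis ι k B := Module.Free.chooseBasis k B
  have hspan : Submodule.span K (Set.range (FreeSemigroup.lift v)) = ⊤ := by
    apply hv
    · rintro _ ⟨t, rfl⟩
      exact Submodule.subset_span ⟨FreeSemigroup.of t, by simp⟩
    · intro x hx y hy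
      have := Submodule.mul_mem_mul hx hy
      rw [Submodule.span_mul_span] at this
      refine Submodule.span_mono ?_ this
      rintro _ ⟨_, ⟨p, rfl⟩, _, ⟨q, rfl⟩, rfl⟩
      exact ⟨p * q, map_mul _ _ _⟩
  obtain ⟨κ, a, -, hsp, hli⟩ := exists_linearIndependent' K (FreeSemigroup.lift v)
  let bK := Module.Basis.mk hli (by rw [hsp, hspan])
  let g : ι ≃ κ := (basis K b).indexEquiv bK
  let S := MvPolynomial (Bool × ι) k
  let X : Bool → S ⊗[k] B := fun t ↦ ∑ i, MvPolynomial.X (t, i) ⊗ₜ b i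
  let φ : S →ₐ[k] K := MvPolynomial.aeval fun p ↦ (basis K b).repr (v p.1) p.2
  have hφ (t : Bool) : map φ (AlgHom.id k B) (X t) = v t := by
    rw [← (basis K b).sum_repr (v t)]
    simp only [X, map_sum, Algebra.TensorProduct.map_tmul, basis_apply, smul_tmul', smul_eq_mul,
      mul_one]
    exact Finset.sum_congr rfl fun i _ ↦ congrArg₂ _ (MvPolynomial.aeval_X _ _) rfl
  let P : S := ((basis S b).toMatrix fun i ↦ FreeSemigroup.lift X (a (g i))).det
  have hP : P ≠ 0 := by
    intro hP
    have h1 := congrArg Matrix.det (toMatrix_lift_map b φ X fun i ↦ a (g i))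
    rw [← AlgHom.mapMatrix_apply, ← AlgHom.map_det] at h1
    change _ = φ P at h1
    rw [hP, map_zero] at h1
    simp only [hφ] at h1
    have h2 : (fun i ↦ FreeSemigroup.lift v (a (g i))) = bK.reindex g.symm := by
      ext i
      simp [bK]
    rw [h2] at h1
    exact ((basis K b).isUnit_det (bK.reindex g.symm)).ne_zero h1
  obtain ⟨z, hz⟩ : ∃ z : Bool × ι → k, MvPolynomial.eval z P ≠ 0 := by
    by_contra! h
    exact hP (MvPolynomial.funext fun z ↦ by simpa using h z)
  let ψ : S →ₐ[k] k := MvPolynomial.aeval z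
  let y : Bool → k ⊗[k] B := fun t ↦ map ψ (AlgHom.id k B) (X t)
  have hy : GeneratesAsNonUnitalAlgebra k (Set.range y) := by
    intro V hs hV
    have h1 := congrArg Matrix.det (toMatrix_lift_map b ψ X fun i ↦ a (g i))
    rw [← AlgHom.mapMatrix_apply, ← AlgHom.map_det] at h1
    have h2 := (Module.Basis.is_basis_iff_det (basis k b)
      (v := fun i ↦ FreeSemigroup.lift y (a (g i)))).2 (by
        rw [Module.Basis.det_apply, h1]
        exact hz.isUnit)
    rw [eq_top_iff, ← h2.2, Submodule.span_le]
    rintro _ ⟨i, rfl⟩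
    change FreeSemigroup.lift y (a (g i)) ∈ V
    induction a (g i) using FreeSemigroup.recOnMul with
    | ih1 t => exact hs ⟨t, by simp⟩
    | ih2 t p ht hp => rw [map_mul]; exact hV _ ht _ hp
  have h := hy.image (Algebra.TensorProduct.lid k B)
  rw [← Set.range_comp] at h
  exact ⟨_, h⟩

theorem HasSeparabilityElement.exists_generatesAsNonUnitalAlgebra {k B : Type*} [Field k]
    [Infinite k] [Ring B] [Algebra k B] [Module.Finite k B] (h : HasSeparabilityElement k B) :
    ∃ w : Bool → B, GeneratesAsNonUnitalAlgebra k (Set.range w) := by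
  let K := AlgebraicClosure k
  have : IsSemisimpleRing (K ⊗[k] B) := (h.baseChange K).isSemisimpleRing
  obtain ⟨n, d, -, ⟨f⟩⟩ := IsSemisimpleRing.exists_algEquiv_pi_matrix_of_isAlgClosed K (K ⊗[k] B)
  obtain ⟨v, hv⟩ := exists_generatesAsNonUnitalAlgebra_pi_matrix K d
  have h := hv.image f.symm
  rw [← Set.range_comp] at h
  exact exists_generatesAsNonUnitalAlgebra_of_baseChange h

end FieldGenerators

section Fibers

variable {R A : Type*} [CommRing R] [Ring A] [Algebra R A]

/-- `s` generates `A` as a non-unital algebra on a neighbourhood of `p`. -/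
def GeneratesNear (s : Set A) (p : Ideal R) : Prop :=
  ∃ f ∉ p, ∀ a : A, f • a ∈ NonUnitalAlgebra.adjoin R s

theorem generatesAsNonUnitalAlgebra_of_generatesNear {s : Set A}
    (h : ∀ p : Ideal R, p.IsMaximal → GeneratesNear s p) : GeneratesAsNonUnitalAlgebra R s := by
  intro V hs hV
  let V' : NonUnitalSubalgebra R A := { V with mul_mem' := fun hx hy ↦ hV _ hx _ hy }
  have hle : NonUnitalAlgebra.adjoin R s ≤ V' := NonUnitalAlgebra.adjoin_le hs
  let I : Ideal R :=
    { carrier := {f | ∀ a : A, f • a ∈ V}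
      add_mem' := fun hf hg a ↦ by rw [add_smul]; exact V.add_mem (hf a) (hg a)
      zero_mem' := fun a ↦ by simp
      smul_mem' := fun c f hf a ↦ by
        rw [smul_eq_mul, mul_smul]; exact V.smul_mem c (hf a) }
  have hI : I = ⊤ := by
    by_contra hI
    obtain ⟨p, hp, hIp⟩ := Ideal.exists_le_maximal I hI
    obtain ⟨f, hf, hfA⟩ := h p hp
    exact hf (hIp fun a ↦ hle (hfA a))
  have h1 : (1 : R) ∈ I := hI ▸ Submodule.mem_top
  exact Submodule.eq_top_iff'.2 fun a ↦ by simpa using h1 a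

theorem GeneratesNear.mono {s t : Set A} {p : Ideal R} (hst : s ⊆ t) (h : GeneratesNear s p) :
    GeneratesNear t p := by
  obtain ⟨f, hf, hfA⟩ := h
  exact ⟨f, hf, fun a ↦ NonUnitalAlgebra.adjoin_mono hst (hfA a)⟩

theorem generatesNear_iff [Module.Finite R A] {s : Set A} {p : Ideal R} (hp : p.IsMaximal) :
    GeneratesNear s p ↔
      ∀ a, ∃ b ∈ NonUnitalAlgebra.adjoin R s, a - b ∈ p • (⊤ : Submodule R A) := by
  constructor
  · rintro ⟨f, hf, hfA⟩ a
    obtain ⟨g, q, hq, hg⟩ := hp.exists_inv hf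
    refine ⟨g • f • a, SMulMemClass.smul_mem g (hfA a), ?_⟩
    have : a - g • f • a = q • a := by
      rw [sub_eq_iff_eq_add, smul_smul, ← add_smul, add_comm, hg, one_smul]
    rw [this]
    exact Submodule.smul_mem_smul hq Submodule.mem_top
  · intro h
    have hle : (⊤ : Submodule R A) ≤
        (NonUnitalAlgebra.adjoin R s).toSubmodule ⊔ p • (⊤ : Submodule R A) := by
      intro a _
      obtain ⟨b, hb, hab⟩ := h a
      exact Submodule.mem_sup.2 ⟨b, hb, a - b, hab, by abel⟩
    obtain ⟨f, hf, hfA⟩ := Submodule.exists_sub_one_mem_and_smul_le_of_fg_of_le_sup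
      (Module.Finite.fg_top (R := R) (M := A)) le_rfl hle
    refine ⟨f, fun hfp ↦ hp.ne_top ((Ideal.eq_top_iff_one p).2 ?_), fun a ↦
      hfA (Submodule.smul_mem_pointwise_smul a f ⊤ Submodule.mem_top)⟩
    simpa using sub_mem hfp hf

theorem GeneratesNear.of_congr [Module.Finite R A] {s t : Set A} {p : Ideal R}
    (hp : p.IsMaximal) (hst : ∀ a ∈ s, ∃ b ∈ t, a - b ∈ p • (⊤ : Submodule R A))
    (h : GeneratesNear s p) : GeneratesNear t p := by
  have hmulr (x y : A) (hx : x ∈ p • (⊤ : Submodule R A)) : x * y ∈ p • (⊤ : Submodule R A) := by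
    induction hx using Submodule.smul_induction_on' with
    | smul r hr n _ =>
      rw [smul_mul_assoc]; exact Submodule.smul_mem_smul hr Submodule.mem_top
    | add x _ z _ hx hz => rw [add_mul]; exact add_mem hx hz
  have hmull (x y : A) (hy : y ∈ p • (⊤ : Submodule R A)) : x * y ∈ p • (⊤ : Submodule R A) := by
    induction hy using Submodule.smul_induction_on' with
    | smul r hr n _ =>
      rw [mul_smul_comm]; exact Submodule.smul_mem_smul hr Submodule.mem_top
    | add y _ z _ hy hz => rw [mul_add]; exact add_mem hy hz
  have hadj (x : A) (hx : x ∈ NonUnitalAlgebra.adjoin R s) :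
      ∃ y ∈ NonUnitalAlgebra.adjoin R t, x - y ∈ p • (⊤ : Submodule R A) := by
    induction hx using NonUnitalAlgebra.adjoin_induction with
    | mem x hx =>
      obtain ⟨y, hy, hxy⟩ := hst x hx
      exact ⟨y, NonUnitalAlgebra.subset_adjoin R hy, hxy⟩
    | zero => exact ⟨0, zero_mem _, by simp⟩
    | add x x' _ _ hx hx' =>
      obtain ⟨y, hy, hxy⟩ := hx
      obtain ⟨y', hy', hxy'⟩ := hx'
      exact ⟨y + y', add_mem hy hy', by rw [add_sub_add_comm]; exact add_mem hxy hxy'⟩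
    | mul x x' _ _ hx hx' =>
      obtain ⟨y, hy, hxy⟩ := hx
      obtain ⟨y', hy', hxy'⟩ := hx'
      refine ⟨y * y', mul_mem hy hy', ?_⟩
      have : x * x' - y * y' = (x - y) * x' + y * (x' - y') := by noncomm_ring
      rw [this]
      exact add_mem (hmulr _ _ hxy) (hmull _ _ hxy')
    | smul r x _ hx =>
      obtain ⟨y, hy, hxy⟩ := hx
      exact ⟨r • y, SMulMemClass.smul_mem r hy, by
        rw [← smul_sub]; exact Submodule.smul_mem _ r hxy⟩
  rw [generatesNear_iff hp] at h ⊢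
  intro a
  obtain ⟨b, hb, hab⟩ := h a
  obtain ⟨c, hc, hbc⟩ := hadj b hb
  exact ⟨c, hc, by simpa using add_mem hab hbc⟩

theorem HasSeparabilityElement.exists_generatesNear [Module.Finite R A]
    (h : HasSeparabilityElement R A) {p : Ideal R} (hp : p.IsMaximal) [Infinite (R ⧸ p)] :
    ∃ v : Bool → A, GeneratesNear (Set.range v) p := by
  let k := R ⧸ p
  let _ : Field k := Ideal.Quotient.field p
  obtain ⟨w, hw⟩ := (h.baseChange k).exists_generatesAsNonUnitalAlgebra
  let f : A →ₐ[R] k ⊗[R] A := Algebra.TensorProduct.includeRight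
  have hf : Function.Surjective f := by
    intro z
    induction z with
    | zero => exact ⟨0, map_zero f⟩
    | add x y hx hy =>
      obtain ⟨a, rfl⟩ := hx
      obtain ⟨b, rfl⟩ := hy
      exact ⟨a + b, map_add f a b⟩
    | tmul c a =>
      obtain ⟨r, rfl⟩ := Ideal.Quotient.mk_surjective c
      refine ⟨r • a, ?_⟩
      change (1 : k) ⊗ₜ[R] (r • a) = _
      rw [tmul_smul, smul_tmul', Algebra.smul_def, mul_one]
      rfl
  have hker (a : A) (ha : f a = 0) : a ∈ p • (⊤ : Submodule R A) := by
    have h1 := congrArg (quotTensorEquivQuotSMul A p) ha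
    rw [map_zero] at h1
    change quotTensorEquivQuotSMul A p (Ideal.Quotient.mk p 1 ⊗ₜ[R] a) = 0 at h1
    rw [quotTensorEquivQuotSMul_mk_tmul, one_smul] at h1
    exact (Submodule.Quotient.mk_eq_zero _).1 h1
  choose v hv using fun t ↦ hf (w t)
  let B := NonUnitalAlgebra.adjoin R (Set.range v)
  let V : Submodule k (k ⊗[R] A) :=
    { carrier := f '' B
      add_mem' := by
        rintro _ _ ⟨a, ha, rfl⟩ ⟨b, hb, rfl⟩
        exact ⟨a + b, add_mem ha hb, map_add f a b⟩
      zero_mem' := ⟨0, zero_mem _, map_zero f⟩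
      smul_mem' := by
        rintro c _ ⟨a, ha, rfl⟩
        obtain ⟨r, rfl⟩ := Ideal.Quotient.mk_surjective c
        refine ⟨r • a, SMulMemClass.smul_mem r ha, ?_⟩
        rw [map_smul]
        exact (algebraMap_smul k r (f a)).symm }
  have hV : V = ⊤ := by
    apply hw
    · rintro _ ⟨t, rfl⟩
      exact ⟨v t, NonUnitalAlgebra.subset_adjoin R ⟨t, rfl⟩, hv t⟩
    · rintro _ ⟨a, ha, rfl⟩ _ ⟨b, hb, rfl⟩
      exact ⟨a * b, mul_mem ha hb, map_mul f a b⟩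
  refine ⟨v, (generatesNear_iff hp).2 fun a ↦ ?_⟩
  obtain ⟨b, hb, hab⟩ : f a ∈ V := hV ▸ Submodule.mem_top
  exact ⟨b, hb, hker _ (by rw [map_sub, hab, sub_self])⟩

end Fibers

section GenericCompletion

variable {R A : Type*} [CommRing R] [Ring A] [Algebra R A]

/-- `s` can be enlarged by at most `i` elements so as to generate `A` near `p`. -/
def CompletableNear (s : Set A) (i : ℕ) (p : Ideal R) : Prop :=
  ∃ t : Finset A, t.card ≤ i ∧ GeneratesNear (s ∪ t) p

theorem CompletableNear.mono {s s' : Set A} {i j : ℕ} {p : Ideal R} (h : CompletableNear s i p)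
    (hs : s ⊆ s') (hij : i ≤ j) : CompletableNear s' j p := by
  obtain ⟨t, ht, h⟩ := h
  exact ⟨t, ht.trans hij, h.mono (Set.union_subset_union_left _ hs)⟩

theorem isClosed_setOf_not_completableNear (s : Set A) (i : ℕ) :
    IsClosed {p : MaximalSpectrum R | ¬ CompletableNear s i p.asIdeal} := by
  rw [← isOpen_compl_iff, isOpen_iff_forall_mem_open]
  intro p hp
  obtain ⟨t, ht, f, hf, hfA⟩ := not_not.1 hp
  refine ⟨MaximalSpectrum.toPrimeSpectrum ⁻¹' (PrimeSpectrum.basicOpen f), ?_, ?_, hf⟩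
  · intro q hq
    exact not_not.2 ⟨t, ht, f, hq, hfA⟩
  · exact (PrimeSpectrum.basicOpen f).isOpen.preimage MaximalSpectrum.toPrimeSpectrum_continuous

theorem exists_completableNear_insert (s : Set A) (p : Ideal R) :
    ∃ c : A, ∀ i, CompletableNear s (i + 1) p → CompletableNear (insert c s) i p := by
  classical
  by_cases h : ∃ i, CompletableNear s (i + 1) p
  · obtain ⟨t, ht, hgen⟩ := Nat.find_spec h
    have hmin (j : ℕ) (hj : CompletableNear s (j + 1) p) : Nat.find h ≤ j := Nat.find_min' h hj
    obtain rfl | ⟨c, hc⟩ := t.eq_empty_or_nonempty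
    · exact ⟨0, fun i _ ↦ ⟨∅, by simp, hgen.mono
        (Set.union_subset_union_left _ (Set.subset_insert _ _))⟩⟩
    · refine ⟨c, fun i hi ↦ CompletableNear.mono (i := Nat.find h) ⟨t.erase c, ?_, ?_⟩
        subset_rfl (hmin i hi)⟩
      · rw [Finset.card_erase_of_mem hc]; omega
      · refine hgen.mono ?_
        intro x hx
        by_cases hxc : x = c
        · simp [hxc]
        · simpa [hxc] using hx
  · exact ⟨0, fun i hi ↦ (h ⟨i, hi⟩).elim⟩

theorem CompletableNear.insert_congr [Module.Finite R A] {s : Set A} {c c' : A} {i : ℕ}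
    {p : Ideal R} (hp : p.IsMaximal) (hc : c - c' ∈ p • (⊤ : Submodule R A))
    (h : CompletableNear (insert c s) i p) : CompletableNear (insert c' s) i p := by
  obtain ⟨t, ht, h⟩ := h
  refine ⟨t, ht, h.of_congr hp ?_⟩
  rintro a ((rfl | ha) | ha)
  · exact ⟨c', by simp, hc⟩
  · exact ⟨a, by simp [ha], by simp⟩
  · exact ⟨a, Or.inr ha, by simp⟩

/-- Chinese remainder theorem for modules, at finitely many maximal ideals. -/
theorem exists_forall_sub_mem_smul_top {M : Type*} [AddCommGroup M] [Module R M]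
    (P : Finset (MaximalSpectrum R)) (c : MaximalSpectrum R → M) :
    ∃ x : M, ∀ p ∈ P, c p - x ∈ p.asIdeal • (⊤ : Submodule R M) := by
  classical
  have hco : Pairwise (Function.onFun IsCoprime fun p : P ↦ p.1.asIdeal) := by
    intro p q hpq
    have := p.1.isMaximal
    have := q.1.isMaximal
    exact Ideal.isCoprime_of_isMaximal fun h ↦ hpq (Subtype.ext (MaximalSpectrum.ext h))
  choose e he using fun q : P ↦ Ideal.exists_forall_sub_mem_ideal hco (Pi.single q 1)
  refine ⟨∑ q : P, e q • c q, fun p hp ↦ ?_⟩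
  have h1 : c p = ∑ q : P, (Pi.single q (1 : R) : P → R) ⟨p, hp⟩ • c q := by
    rw [Finset.sum_eq_single ⟨p, hp⟩]
    · simp
    · intro q _ hq
      simp [hq.symm]
    · simp
  rw [h1, ← Finset.sum_sub_distrib]
  refine Submodule.sum_mem _ fun q _ ↦ ?_
  rw [← sub_smul, ← neg_sub, neg_smul]
  exact Submodule.neg_mem _ (Submodule.smul_mem_smul (he q ⟨p, hp⟩) Submodule.mem_top)

open TopologicalSpace in
/-- If the locus where `s` needs more than `i` further elements has dimension less than `n - i`
for all `i`, then `s` can be completed to a generating set by `n` elements. -/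
theorem exists_finset_generatesNear [IsNoetherianRing R] [Module.Finite R A] (n : ℕ) (s : Set A)
    (h : ∀ (i : ℕ) (Z : IrreducibleCloseds (MaximalSpectrum R)),
      (∀ p ∈ Z, ¬ CompletableNear s i p.asIdeal) → i + 1 + Order.height Z ≤ (n : ℕ∞)) :
    ∃ t : Finset A, t.card ≤ n ∧
      ∀ p : Ideal R, p.IsMaximal → GeneratesNear (s ∪ t) p := by
  classical
  induction n generalizing s with
  | zero =>
    refine ⟨∅, by simp, fun p hp ↦ ?_⟩
    by_contra hgen
    have := h 0 {⟨p, hp⟩} (by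
      rintro q rfl ⟨t, ht, hq⟩
      obtain rfl : t = ∅ := by simpa using ht
      exact hgen hq)
    simp at this
  | succ n ih =>
    have : NoetherianSpace (MaximalSpectrum R) :=
      Topology.IsInducing.noetherianSpace (i := MaximalSpectrum.toPrimeSpectrum) ⟨rfl⟩
    let G (i : ℕ) : Set (MaximalSpectrum R) := {p | ¬ CompletableNear s i p.asIdeal}
    have hP : ∀ i, ∃ P : Finset (MaximalSpectrum R), ∀ Z : IrreducibleCloseds (MaximalSpectrum R),
        (Z : Set _) ⊆ G i → ¬ (Z : Set _) ⊆ G (i + 1) →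
        ∃ Z' : IrreducibleCloseds (MaximalSpectrum R), Z ≤ Z' ∧ (Z' : Set _) ⊆ G i ∧
          ∃ p ∈ P, p ∈ Z' ∧ p ∉ G (i + 1) := by
      intro i
      obtain ⟨C, hC, hCc, hCi, hCG⟩ := NoetherianSpace.exists_finite_set_isClosed_irreducible
        (isClosed_setOf_not_completableNear (R := R) s i)
      have hpt (Z : Set (MaximalSpectrum R)) : ∃ P : Finset (MaximalSpectrum R),
          ¬ Z ⊆ G (i + 1) → ∃ p ∈ P, p ∈ Z ∧ p ∉ G (i + 1) := by
        by_cases hZ : Z ⊆ G (i + 1)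
        · exact ⟨∅, fun h ↦ (h hZ).elim⟩
        · obtain ⟨p, hp, hp'⟩ := Set.not_subset.1 hZ
          exact ⟨{p}, fun _ ↦ ⟨p, by simp, hp, hp'⟩⟩
      choose P hP using hpt
      refine ⟨hC.toFinset.biUnion P, fun Z hZ hZ' ↦ ?_⟩
      obtain ⟨W, hW, hZW⟩ : ∃ W ∈ C, (Z : Set _) ⊆ W := by
        refine (isIrreducible_iff_sUnion_isClosed.1 Z.isIrreducible) hC.toFinset ?_ ?_ |>.imp ?_
        · simpa using hCc
        · rw [hC.coe_toFinset, ← hCG]; exact hZ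
        · simp
      obtain ⟨p, hpP, hpW, hp⟩ := hP W fun hW ↦ hZ' (hZW.trans hW)
      refine ⟨⟨W, hCi W hW, hCc W hW⟩, hZW, ?_, p, ?_, hpW, hp⟩
      · exact (Set.subset_sUnion_of_mem hW).trans hCG.symm.subset
      · exact Finset.mem_biUnion.2 ⟨W, by simpa using hW, hpP⟩
    choose P hP using hP
    choose c hc using fun p : MaximalSpectrum R ↦ exists_completableNear_insert s p.asIdeal
    obtain ⟨x, hx⟩ := exists_forall_sub_mem_smul_top ((Finset.range (n + 1)).biUnion P) c
    obtain ⟨t, ht, hgen⟩ := ih (insert x s) fun i Z hZ ↦ by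
      have hZG : (Z : Set _) ⊆ G i :=
        fun p hp hcomp ↦ hZ p hp (hcomp.mono (Set.subset_insert _ _) le_rfl)
      by_cases hZ' : (Z : Set _) ⊆ G (i + 1)
      · have := h (i + 1) Z hZ'
        push_cast at this
        rw [add_right_comm] at this
        exact (ENat.add_le_add_iff_right ENat.one_ne_top).1 this
      · obtain ⟨Z', hZZ', hZ'G, p, hpP, hpZ', hp⟩ := hP i Z hZG hZ'
        have hn := h i Z' hZ'G
        have hin : i ∈ Finset.range (n + 1) := by
          have : ((i + 1 : ℕ) : ℕ∞) ≤ (n + 1 : ℕ) := by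
            push_cast at hn ⊢
            exact le_self_add.trans hn
          have := Nat.cast_le.1 this
          simp; omega
        have hpZ : p ∉ Z := fun hpZ ↦ hZ p hpZ <| (hc p i (not_not.1 hp)).insert_congr
          p.isMaximal (hx p (Finset.mem_biUnion.2 ⟨i, hin, hpP⟩))
        have hlt : Z < Z' := lt_of_le_of_ne hZZ' fun h ↦ hpZ (h ▸ hpZ')
        have hht := Order.height_add_one_le hlt
        have : (i + 1 + Order.height Z) + 1 ≤ (n : ℕ∞) + 1 := by
          rw [add_assoc]
          push_cast at hn
          exact (add_le_add_right hht _).trans hn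
        exact (ENat.add_le_add_iff_right ENat.one_ne_top).1 this
    refine ⟨insert x t, (Finset.card_insert_le _ _).trans (by omega), fun p hp ↦ ?_⟩
    refine (hgen p hp).mono ?_
    rw [Finset.coe_insert, Set.union_insert, Set.insert_union]

end GenericCompletion

/-- If R is Noetherian with dim Max R = d and no finite homomorphic images (all residue fields
R/p, p maximal, are infinite), then every finite separable associative unital R-algebra (A is
projective as a module over A ⊗ Aᵐᵒᵖ acting by (a ⊗ bᵒᵖ)·x = axb) can be generated by d + 2
elements as a non-unital R-algebra. -/
theorem separable_algebra_generators (R : Type) [CommRing R] [IsNoetherianRing R] (d : ℕ)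
    (hd : topologicalKrullDim (MaximalSpectrum R) = d)
    (hres : ∀ (p : Ideal R), p.IsMaximal → Infinite (R ⧸ p))
    (A : Type) [Ring A] [Algebra R A] [Module.Finite R A]
    (hsep : Module.Projective (A ⊗[R] Aᵐᵒᵖ) A) :
    ∃ s : Finset A, s.card ≤ d + 2 ∧ GeneratesAsNonUnitalAlgebra R (s : Set A) := by
  classical
  have hA := HasSeparabilityElement.of_projective hsep
  obtain ⟨t, ht, hgen⟩ := exists_finset_generatesNear (R := R) (A := A) (d + 2) ∅ fun i Z hZ ↦ by
    obtain ⟨p, hp⟩ := Z.isIrreducible.nonempty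
    have := hres p.asIdeal p.isMaximal
    obtain ⟨v, hv⟩ := hA.exists_generatesNear p.isMaximal
    have hi : i < 2 := by
      by_contra! hi
      refine hZ p hp ⟨Finset.univ.image v, ?_, hv.mono (by simp [Set.pair_subset_iff])⟩
      exact (Finset.card_image_le).trans (by simpa using hi)
    have hZd : Order.height Z ≤ d := by
      have := (Order.height_le_krullDim Z).trans_eq hd
      exact_mod_cast this
    calc (i : ℕ∞) + 1 + Order.height Z ≤ 2 + d :=
          add_le_add (by exact_mod_cast hi) hZd
      _ = (d + 2 : ℕ) := by push_cast; ring
  exact ⟨t, ht, by simpa using generatesAsNonUnitalAlgebra_of_generatesNear hgen⟩
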